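/- arXiv:1503.05021 — 2 statements merged into one kernel-verified Lean document; each statement's English description precedes it below -/
import Mathlib

section
/- Let p be a prime, n ≥ 1, and let k be a field of characteristic 0. If (k, pⁿ) is not the special case, then every element of kˣ that is a pⁿ-th power in k(μ_{pⁿ}) is already a pⁿ-th power in k (i.e. H¹(k(μ_{pⁿ})/k, μ_{pⁿ}) = 0). If (k, 2ⁿ) is the special case, then the kernel of the natural map kˣ/kˣ^{2ⁿ} → k(μ_{2ⁿ})ˣ/k(μ_{2ⁿ})ˣ^{2ⁿ} is a group of order exactly 2 (i.e. H¹(k(μ_{2ⁿ})/k, μ_{2ⁿ}) ≅ ℤ/2ℤ). -/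
/-- The field `k(μ_m)` obtained by adjoining all `m`-th roots of unity, realised inside an
algebraic closure of `k`. -/
noncomputable def cycloExt (k : Type*) [Field k] (m : ℕ) :
    IntermediateField k (AlgebraicClosure k) :=
  IntermediateField.adjoin k {x : AlgebraicClosure k | x ^ m = 1}

/-- `(k, pⁿ)` is the *special case*: `p = 2`, `n ≥ 2`, and there is a `k`-automorphism of
`k(μ_{2ⁿ})` inverting all `2ⁿ`-th roots of unity (equivalently, `k ∩ ℚ(μ_{2ⁿ})` is totally
real). -/
def IsSpecialCase (k : Type*) [Field k] (p n : ℕ) : Prop :=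
  p = 2 ∧ 2 ≤ n ∧
    ∃ σ : cycloExt k (2 ^ n) ≃ₐ[k] cycloExt k (2 ^ n),
      ∀ ζ : cycloExt k (2 ^ n), ζ ^ 2 ^ n = 1 → σ ζ = ζ⁻¹

/-- The natural map `kˣ/kˣ^m → Kˣ/Kˣ^m` induced by the inclusion `k ⊆ K`. -/
noncomputable def powQuotMap (k K : Type*) [Field k] [Field K] [Algebra k K] (m : ℕ) :
    kˣ ⧸ (powMonoidHom m : kˣ →* kˣ).range →* Kˣ ⧸ (powMonoidHom m : Kˣ →* Kˣ).range :=
  QuotientGroup.lift _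
    ((QuotientGroup.mk' _).comp (Units.map (algebraMap k K : k →+* K).toMonoidHom))
    (by
      rintro x ⟨y, rfl⟩
      rw [MonoidHom.mem_ker, MonoidHom.comp_apply, QuotientGroup.mk'_apply,
        QuotientGroup.eq_one_iff]
      exact ⟨Units.map (algebraMap k K : k →+* K).toMonoidHom y, by
        simp [powMonoidHom_apply, map_pow]⟩)

/-- The kernel of `kˣ/kˣ^m → Kˣ/Kˣ^m`; by inflation–restriction and Hilbert 90 this is
`H¹(K/k, μ_m(K))` when `K/k` is Galois with `μ_m ⊆ K`. -/
noncomputable def powQuotKernel (k K : Type*) [Field k] [Field K] [Algebra k K] (m : ℕ) :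
    Subgroup (kˣ ⧸ (powMonoidHom m : kˣ →* kˣ).range) :=
  (powQuotMap k K m).ker

theorem gw_solve (p n a c u : ℕ) (hp : p.Prime) (hu : 1 < u)
    (ha : padicValNat p (u - 1) = a) (hc : p ^ a ∣ c) :
    ∃ d : ℕ, p ^ n ∣ (u - 1) * d + c := by
  have := Fact.mk hp
  have : NeZero (p ^ n) := ⟨(pow_pos hp.pos n).ne'⟩
  obtain ⟨w, hw⟩ : p ^ a ∣ u - 1 := ha ▸ pow_padicValNat_dvd
  obtain ⟨c', rfl⟩ := hc
  have hwp : ¬ p ∣ w := by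
    rintro ⟨t, rfl⟩
    have : p ^ (padicValNat p (u - 1) + 1) ∣ u - 1 := by
      rw [ha, hw, pow_succ]; exact ⟨t, by ring⟩
    exact pow_succ_padicValNat_not_dvd (by omega) this
  have hcop : Nat.Coprime w (p ^ n) :=
    (Nat.Coprime.pow_left n ((Nat.Prime.coprime_iff_not_dvd hp).2 hwp)).symm
  refine ⟨(-((w : ZMod (p ^ n))⁻¹ * c') : ZMod (p ^ n)).val, ?_⟩
  rw [← ZMod.natCast_eq_zero_iff, hw]
  push_cast
  rw [ZMod.natCast_zmod_val]
  have := ZMod.coe_mul_inv_eq_one w hcop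
  linear_combination (-(p:ZMod (p^n))^a * c') * this

theorem gw_num (p n c u : ℕ) (hp : p.Prime) (hu : 1 < u) (hpu : ¬ p ∣ u)
    (hns : p = 2 → 2 ≤ n → ¬ 2 ^ n ∣ u + 1)
    (H : ∀ N, p ^ n ∣ u ^ N - 1 → p ^ n ∣ c * ∑ i ∈ Finset.range N, u ^ i) :
    ∃ d : ℕ, p ^ n ∣ (u - 1) * d + c := by
  have := Fact.mk hp
  rcases le_or_gt n (padicValNat p (u - 1)) with hna | hna
  · have h1 : p ^ n ∣ c := by
      have := H 1 (by rw [pow_one]; exact (pow_dvd_pow p hna).trans pow_padicValNat_dvd)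
      simpa using this
    exact ⟨0, by simpa using h1⟩
  suffices h : p ∣ u - 1 → ∃ N, N ≠ 0 ∧ padicValNat p (u ^ N - 1) = n by
    by_cases hpd : p ∣ u - 1
    · obtain ⟨N, hN0, hN⟩ := h hpd
      refine gw_solve p n _ c u hp hu rfl ?_
      by_cases hc0 : c = 0
      · simp [hc0]
      have hdvd := H N (hN ▸ pow_padicValNat_dvd)
      have hg : (∑ i ∈ Finset.range N, u ^ i) * (u - 1) = u ^ N - 1 := by
        have := Nat.geomSum_eq (m := u) hu N
        rw [this]
        exact Nat.div_mul_cancel (Nat.sub_one_dvd_pow_sub_one u N)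
      have hpos : u ^ N - 1 ≠ 0 := by
        have := Nat.one_lt_pow hN0 hu
        omega
      have hS0 : (∑ i ∈ Finset.range N, u ^ i) ≠ 0 := by
        intro h0; rw [h0, zero_mul] at hg; exact hpos hg.symm
      have hval : padicValNat p (∑ i ∈ Finset.range N, u ^ i) + padicValNat p (u - 1) = n := by
        rw [← padicValNat.mul hS0 (by omega), hg, hN]
      have h2 : n ≤ padicValNat p (c * ∑ i ∈ Finset.range N, u ^ i) :=
        (padicValNat_dvd_iff_le (mul_ne_zero hc0 hS0)).1 hdvd
      rw [padicValNat.mul hc0 hS0] at h2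
      exact (padicValNat_dvd_iff_le hc0).2 (by omega)
    · exact gw_solve p n 0 c u hp hu (padicValNat.eq_zero_of_not_dvd hpd) (by simp)
  intro hpd
  by_cases h2 : p = 2
  · subst h2
    have ha1 : 1 ≤ padicValNat 2 (u - 1) := one_le_padicValNat_of_dvd (by omega) hpd
    have hb1 : 1 ≤ padicValNat 2 (u + 1) := one_le_padicValNat_of_dvd (by omega) (by omega)
    have hbn : padicValNat 2 (u + 1) < n := by
      by_contra hcon
      exact hns rfl (by omega) ((padicValNat_dvd_iff_le (by omega)).2 (by omega))
    have hmin : padicValNat 2 (u - 1) = 1 ∨ padicValNat 2 (u + 1) = 1 := by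
      by_contra hcon
      have h3 : 2 ^ 2 ∣ u - 1 := (padicValNat_dvd_iff_le (by omega)).2 (by omega)
      have h4 : 2 ^ 2 ∣ u + 1 := (padicValNat_dvd_iff_le (by omega)).2 (by omega)
      omega
    refine ⟨2 ^ (n + 1 - padicValNat 2 (u - 1) - padicValNat 2 (u + 1)), by positivity, ?_⟩
    have := padicValNat.pow_two_sub_one (x := u)
      (n := 2 ^ (n + 1 - padicValNat 2 (u - 1) - padicValNat 2 (u + 1))) hu hpu (by positivity)
      (by rw [Nat.even_pow]; exact ⟨even_two, by omega⟩)
    rw [padicValNat.prime_pow] at this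
    omega
  · refine ⟨p ^ (n - padicValNat p (u - 1)), (pow_pos hp.pos _).ne', ?_⟩
    have := padicValNat.pow_sub_pow (p := p) (hp.odd_of_ne_two h2) (x := u) (y := 1) hu hpd hpu
      (n := p ^ (n - padicValNat p (u - 1))) (pow_pos hp.pos _).ne'
    rw [padicValNat.prime_pow, one_pow] at this
    omega

theorem gw_cyclic_two (n : ℕ) (G : Type*) [Group G] (f : G →* (ZMod (2 ^ n))ˣ)
    (hf : Function.Injective f) (hG : 2 ≤ n → ∀ g, f g ≠ -1) : IsCyclic G := by
  rcases le_or_gt n 2 with hn | hn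
  · have : IsCyclic (ZMod (2 ^ n))ˣ := (ZMod.isCyclic_units_two_pow_iff n).2 hn
    exact isCyclic_of_injective f hf
  obtain ⟨m, rfl⟩ : ∃ m, n = m + 3 := ⟨n - 3, by omega⟩
  have h5 : Nat.Coprime 5 (2 ^ (m + 3)) := Nat.Coprime.pow_right _ (by norm_num)
  set F : (ZMod (2 ^ (m+3)))ˣ := ZMod.unitOfCoprime 5 h5 with hF
  have hord : orderOf F = 2 ^ (m + 1) := by
    rw [← orderOf_units, hF, ZMod.coe_unitOfCoprime]
    exact_mod_cast ZMod.orderOf_five (m + 1)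
  have : NeZero (2 ^ (m+3)) := ⟨by positivity⟩
  have hcard : Nat.card (ZMod (2 ^ (m+3)))ˣ = 2 ^ (m + 2) := by
    rw [Nat.card_eq_fintype_card, ZMod.card_units_eq_totient,
      Nat.totient_prime_pow_succ Nat.prime_two]
    simp
  have hidx : (Subgroup.zpowers F).index = 2 := by
    have := Subgroup.card_mul_index (Subgroup.zpowers F)
    rw [Nat.card_zpowers, hord, hcard, pow_succ] at this
    exact Nat.eq_of_mul_eq_mul_left (by positivity) this
  let r : (ZMod (2 ^ (m+3)))ˣ →* (ZMod 4)ˣ :=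
    ZMod.unitsMap (show 4 ∣ 2 ^ (m+3) from ⟨2 ^ (m+1), by ring⟩)
  have hr5 : r F = 1 := by
    apply Units.ext
    have h1 : ((r F : (ZMod 4)ˣ) : ZMod 4) = ZMod.castHom
        (show 4 ∣ 2 ^ (m+3) from ⟨2 ^ (m+1), by ring⟩) (ZMod 4) ((5 : ℕ) : ZMod (2 ^ (m+3))) := rfl
    rw [h1, map_natCast]
    rfl
  have hrm : r (-1) ≠ 1 := by
    intro h
    have := congrArg Units.val h
    simp [r, ZMod.unitsMap_def] at this
    revert this
    decide
  have hneg : (-1 : (ZMod (2 ^ (m+3)))ˣ) ∉ Subgroup.zpowers F := by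
    rintro ⟨i, hi⟩
    apply hrm
    rw [← hi]
    simp [hr5]
  let Q := (ZMod (2 ^ (m+3)))ˣ ⧸ Subgroup.zpowers (-1 : (ZMod (2 ^ (m+3)))ˣ)
  have : IsCyclic Q := by
    refine ⟨(QuotientGroup.mk F : Q), ?_⟩
    intro x
    induction x using QuotientGroup.induction_on with
    | H z =>
    by_cases hz : z ∈ Subgroup.zpowers F
    · obtain ⟨i, rfl⟩ := hz
      exact ⟨i, rfl⟩
    · have : (-1) * z ∈ Subgroup.zpowers F := by
        rw [Subgroup.mul_mem_iff_of_index_two hidx]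
        simp [hneg, hz]
      obtain ⟨i, hi⟩ := this
      refine ⟨i, ?_⟩
      have h1 : ((F ^ i : (ZMod (2 ^ (m+3)))ˣ) : Q) = (z : Q) := by
        rw [QuotientGroup.eq]
        simp only at hi
        rw [hi]
        exact ⟨1, by simp⟩
      exact h1
  refine isCyclic_of_injective ((QuotientGroup.mk' (Subgroup.zpowers (-1 : (ZMod (2 ^ (m+3)))ˣ))).comp f) ?_
  rw [injective_iff_map_eq_one]
  intro g hg
  have hg' : f g ∈ Subgroup.zpowers (-1 : (ZMod (2 ^ (m+3)))ˣ) := by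
    simpa using hg
  obtain ⟨i, hi⟩ := hg'
  rcases Int.even_or_odd i with he | ho
  · simp only [he.neg_one_zpow] at hi
    exact hf (by rw [← hi, map_one])
  · simp only [ho.neg_one_zpow] at hi
    exact absurd hi.symm (hG (by omega) g)

theorem gw_field {F K : Type*} [Field F] [Field K] [Algebra F K] [FiniteDimensional F K]
    [IsGalois F K] (p n : ℕ) (hp : p.Prime) (ζ : K) (hζ : IsPrimitiveRoot ζ (p ^ n))
    (hgen : ∀ σ : K ≃ₐ[F] K, σ ζ = ζ → σ = 1)
    (hns : p = 2 → 2 ≤ n → ∀ σ : K ≃ₐ[F] K, σ ζ ≠ ζ⁻¹)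
    (x : F) (y : K) (hy0 : y ≠ 0) (hy : y ^ p ^ n = algebraMap F K x) :
    ∃ (d : ℕ) (z : F), algebraMap F K z = ζ ^ d * y := by
  have : NeZero (p ^ n) := ⟨(pow_pos hp.pos n).ne'⟩
  rcases Nat.eq_zero_or_pos n with hn0 | hn0
  · subst hn0
    exact ⟨0, x, by simpa using hy.symm⟩
  have hζ0 : ζ ≠ 0 := hζ.ne_zero (NeZero.ne _)
  have hinj : Function.Injective (hζ.autToPow F) := by
    rw [injective_iff_map_eq_one]
    intro σ hσ
    apply hgen
    rw [← hζ.autToPow_spec F σ, hσ]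
    rcases Nat.lt_or_ge 1 (p ^ n) with h1 | h1
    · have : Fact (1 < p ^ n) := ⟨h1⟩
      simp [ZMod.val_one]
    · exact absurd h1 (not_le.2 (Nat.one_lt_pow hn0.ne' hp.one_lt))
  have hcyc : IsCyclic (K ≃ₐ[F] K) := by
    by_cases h2 : p = 2
    · subst h2
      refine gw_cyclic_two n _ (hζ.autToPow F) hinj ?_
      intro hn g hg
      apply hns rfl hn g
      rw [← hζ.autToPow_spec F g, hg]
      apply eq_inv_of_mul_eq_one_left
      rw [← pow_succ, hζ.pow_eq_one_iff_dvd, ← ZMod.natCast_eq_zero_iff]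
      push_cast
      rw [ZMod.natCast_zmod_val]
      simp
    · have := ZMod.isCyclic_units_of_prime_pow p hp h2 n
      exact isCyclic_of_injective _ hinj
  obtain ⟨σ, hσ⟩ := hcyc.exists_generator
  set v := ((hζ.autToPow F σ : (ZMod (p ^ n))ˣ) : ZMod (p ^ n)).val with hv
  have hσv : σ ζ = ζ ^ v := (hζ.autToPow_spec F σ).symm
  have hvcop : Nat.Coprime v (p ^ n) := ZMod.val_coe_unit_coprime _
  set u := v + p ^ n with hu
  have hσu : σ ζ = ζ ^ u := by rw [hσv, hu, pow_add, hζ.pow_eq_one, mul_one]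
  have hu1 : 1 < u := by
    have := Nat.one_lt_pow hn0.ne' hp.one_lt
    omega
  have hpu : ¬ p ∣ u := by
    intro h
    have h1 : p ∣ p ^ n := dvd_pow_self p hn0.ne'
    have h2 : p ∣ v := (Nat.dvd_add_left h1).1 h
    exact hp.one_lt.ne' (Nat.dvd_one.1 (hvcop ▸ Nat.dvd_gcd h2 h1))
  obtain ⟨c, -, hc⟩ : ∃ c < p ^ n, ζ ^ c = σ y / y := by
    apply hζ.eq_pow_of_pow_eq_one
    rw [div_pow, ← map_pow, hy, AlgEquiv.commutes, div_self]
    rw [← hy]; exact pow_ne_zero _ hy0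
  have hc' : σ y = ζ ^ c * y := by rw [hc, div_mul_cancel₀ _ hy0]
  have hit : ∀ N : ℕ, (σ ^ N) ζ = ζ ^ (u ^ N) ∧
      (σ ^ N) y = ζ ^ (c * ∑ i ∈ Finset.range N, u ^ i) * y := by
    intro N
    induction N with
    | zero => simp
    | succ N ih =>
      rw [pow_succ', AlgEquiv.mul_apply, AlgEquiv.mul_apply, ih.1, ih.2]
      constructor
      · rw [map_pow, hσu, ← pow_mul, pow_succ']
      · rw [map_mul, map_pow, hσu, hc', geom_sum_succ]
        ring
  obtain ⟨d, hd⟩ := gw_num p n c u hp hu1 hpu (by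
    intro h2 hn hdvd
    apply hns h2 hn σ
    subst h2
    apply eq_inv_of_mul_eq_one_left
    rw [hσu, ← pow_succ, hζ.pow_eq_one_iff_dvd]
    exact hdvd) (by
    intro N hN
    have h1 : σ ^ N = 1 := by
      apply hgen
      rw [(hit N).1]
      have h2 : u ^ N = (u ^ N - 1) + 1 := by
        have := Nat.one_le_pow N u (by omega)
        omega
      rw [h2, pow_succ, (hζ.pow_eq_one_iff_dvd _).2 hN, one_mul]
    have h3 := (hit N).2
    rw [h1, AlgEquiv.one_apply] at h3
    rw [← hζ.pow_eq_one_iff_dvd]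
    exact mul_right_cancel₀ hy0 (by rw [one_mul]; exact h3.symm))
  refine ⟨d, ?_⟩
  have hfix : σ (ζ ^ d * y) = ζ ^ d * y := by
    have h1 : u * d + c = ((u - 1) * d + c) + d := by
      obtain ⟨w, hw⟩ : ∃ w, u = w + 1 := ⟨u - 1, by omega⟩
      rw [hw]; simp; ring
    rw [map_mul, map_pow, hσu, hc', ← pow_mul, ← mul_assoc, ← pow_add, h1, pow_add,
      (hζ.pow_eq_one_iff_dvd _).2 hd, one_mul]
  have : ζ ^ d * y ∈ Set.range (algebraMap F K) := by
    rw [IsGalois.mem_range_algebraMap_iff_fixed]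
    intro f
    have hle : Subgroup.zpowers σ ≤ MulAction.stabilizer (K ≃ₐ[F] K) (ζ ^ d * y) := by
      rw [Subgroup.zpowers_le]
      exact hfix
    exact hle (hσ f)
  exact this

theorem gw_special {k K : Type*} [Field k] [Field K] [Algebra k K] [FiniteDimensional k K]
    [IsGalois k K] (n : ℕ) (hn : 2 ≤ n) (ζ : K) (hζ : IsPrimitiveRoot ζ (2 ^ n))
    (hgen : ∀ σ : K ≃ₐ[k] K, σ ζ = ζ → σ = 1) (τ : K ≃ₐ[k] K) (hτ : τ ζ = ζ⁻¹) :
    ∃ (y0 : K) (x0 : k), y0 ≠ 0 ∧ y0 ^ 2 ^ n = algebraMap k K x0 ∧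
      (¬ ∃ z : k, z ^ 2 ^ n = x0) ∧
      ∀ (x : k) (y : K), y ≠ 0 → y ^ 2 ^ n = algebraMap k K x →
        (∃ z : k, z ^ 2 ^ n = x) ∨ ∃ z : k, z ^ 2 ^ n * x0 = x := by
  have : NeZero (2 ^ n) := ⟨by positivity⟩
  have hζ0 : ζ ≠ 0 := hζ.ne_zero (NeZero.ne _)
  obtain ⟨i, hi⟩ : ∃ i, i = ζ ^ 2 ^ (n - 2) := ⟨_, rfl⟩
  have hi4 : IsPrimitiveRoot i 4 := by
    rw [hi]
    refine hζ.pow (by positivity) ?_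
    rw [show (4 : ℕ) = 2 ^ 2 by norm_num, ← pow_add]
    congr 1; omega
  have hi2 : i ^ 2 = -1 := by
    have h := hi4.pow_of_dvd (p := 2) (by norm_num) (by norm_num)
    exact h.eq_neg_one_of_two_right
  have hi0 : i ≠ 0 := hi4.ne_zero (by norm_num)
  have hii : i ≠ -i := by
    intro h
    have h1 : i ^ 2 = 1 ∨ True := Or.inr trivial
    have h2 : i * (1 - -1 : K) = 0 := by linear_combination h
    rcases mul_eq_zero.1 h2 with h3 | h3
    · exact hi0 h3
    · have : i ^ 2 = 1 := by rw [hi2]; linear_combination -h3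
      exact absurd (hi4.dvd_of_pow_eq_one 2 this) (by norm_num)
  have hroot : ∀ ξ : K, ξ ^ 2 ^ n = 1 → τ ξ = ξ⁻¹ := by
    intro ξ hξ
    obtain ⟨j, -, rfl⟩ := hζ.eq_pow_of_pow_eq_one hξ
    rw [map_pow, hτ, inv_pow]
  have hτi : τ i = -i := by
    rw [hi, map_pow, hτ, inv_pow, ← hi]
    apply inv_eq_of_mul_eq_one_left
    linear_combination -hi2
  let F : IntermediateField k K := IntermediateField.adjoin k {i}
  have hiF : i ∈ F := IntermediateField.mem_adjoin_simple_self k i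
  have hτF : ∀ z ∈ F, τ z ∈ F := by
    have hle : F ≤ F.comap (τ : K →ₐ[k] K) := by
      rw [IntermediateField.adjoin_le_iff]
      intro a ha
      rw [Set.mem_singleton_iff] at ha
      subst ha
      change τ a ∈ F
      rw [hτi]
      exact neg_mem hiF
    exact fun z hz => hle hz
  have hfixF : ∀ σ : K ≃ₐ[k] K, σ i = i → ∀ z ∈ F, σ z = z := by
    intro σ hσ z hz
    induction hz using IntermediateField.adjoin_induction with
    | mem a ha =>
      rw [Set.mem_singleton_iff] at ha
      rw [ha, hσ]
    | algebraMap a => exact σ.commutes a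
    | add a b _ _ ha hb => rw [map_add, ha, hb]
    | inv a _ ha => rw [map_inv₀, ha]
    | mul a b _ _ ha hb => rw [map_mul, ha, hb]
  have hdesc : ∀ z ∈ F, τ z = z → ∃ w : k, algebraMap k K w = z := by
    intro z hz hτz
    have : z ∈ Set.range (algebraMap k K) := by
      rw [IsGalois.mem_range_algebraMap_iff_fixed]
      intro σ
      have h1 : σ i = i ∨ σ i = -i := by
        have : σ i ^ 2 = i ^ 2 := by rw [← map_pow, hi2, map_neg, map_one]
        exact sq_eq_sq_iff_eq_or_eq_neg.1 this
      rcases h1 with h1 | h1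
      · exact hfixF σ h1 z hz
      · have h2 : (τ * σ) i = i := by
          rw [AlgEquiv.mul_apply, h1, map_neg, hτi, neg_neg]
        have h3 := hfixF _ h2 z hz
        rw [AlgEquiv.mul_apply] at h3
        apply τ.injective
        rw [h3, hτz]
    exact this
  -- the roots of unity of `F`
  obtain ⟨ω, hωF, hω1, hω⟩ : ∃ ω ∈ F, ω ^ 2 ^ n = 1 ∧
      ∀ ξ ∈ F, ξ ^ 2 ^ n = 1 → ∃ j : ℕ, ξ = ω ^ j := by
    obtain ⟨g, hg⟩ := (inferInstance : IsCyclic (rootsOfUnity (2 ^ n) F)).exists_generator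
    refine ⟨((g : Fˣ) : F), ((g : Fˣ) : F).2, ?_, ?_⟩
    · have h1 : ((g : Fˣ) : F) ^ 2 ^ n = 1 := by
        have := (mem_rootsOfUnity' _ _).1 g.2
        exact this
      exact_mod_cast congrArg (fun t : F => (t : K)) h1
    · intro ξ hξF hξ
      have h1 : (⟨ξ, hξF⟩ : F) ^ 2 ^ n = 1 := Subtype.ext hξ
      obtain ⟨j, hj⟩ := (mem_powers_iff_mem_zpowers).2 (hg (rootsOfUnity.mkOfPowEq _ h1))
      refine ⟨j, ?_⟩
      have h2 := congrArg (fun t : rootsOfUnity (2 ^ n) F => (((t : Fˣ) : F) : K)) hj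
      simp at h2
      exact h2.symm
  have hω0 : ω ≠ 0 := by
    rintro rfl
    rw [zero_pow (by positivity)] at hω1
    exact zero_ne_one hω1
  have hτω : τ ω = ω⁻¹ := hroot ω hω1
  obtain ⟨j0, hj0⟩ := hω i hiF (by rw [hi, ← pow_mul, mul_comm, pow_mul, hζ.pow_eq_one, one_pow])
  have hωs : ω ^ 2 ≠ 1 := by
    intro h
    have : i ^ 2 = 1 := by rw [hj0, ← pow_mul, mul_comm, pow_mul, h, one_pow]
    exact absurd (hi4.dvd_of_pow_eq_one 2 this) (by norm_num)
  have hω1' : ω ≠ 1 := by rintro rfl; exact hωs (one_pow _)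
  have h1ω : 1 + ω ≠ 0 := by
    intro h
    apply hωs
    have : ω = -1 := by linear_combination h
    rw [this]; ring
  have hτ1 : τ (1 + ω) = ω⁻¹ * (1 + ω) := by
    rw [map_add, map_one, hτω]; field_simp; ring
  have hωinv : ω⁻¹ ^ 2 ^ n = 1 := by rw [inv_pow, hω1, inv_one]
  have h1F : 1 + ω ∈ F := add_mem (one_mem F) hωF
  obtain ⟨x0, hx0⟩ := hdesc ((1 + ω) ^ 2 ^ n) (pow_mem h1F _) (by
    rw [map_pow, hτ1, mul_pow, hωinv, one_mul])
  refine ⟨1 + ω, x0, h1ω, hx0.symm, ?_, ?_⟩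
  · rintro ⟨z, hz⟩
    have hz' : (algebraMap k K z) ^ 2 ^ n = (1 + ω) ^ 2 ^ n := by rw [← map_pow, hz, hx0]
    have hz0 : algebraMap k K z ≠ 0 := by
      intro h
      rw [h, zero_pow (by positivity)] at hz'
      exact pow_ne_zero _ h1ω hz'.symm
    have hρ1 : ((1 + ω) / algebraMap k K z) ^ 2 ^ n = 1 := by
      rw [div_pow, hz', div_self (pow_ne_zero _ h1ω)]
    have hρF : (1 + ω) / algebraMap k K z ∈ F := div_mem h1F (F.algebraMap_mem z)
    obtain ⟨j, hj⟩ := hω _ hρF hρ1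
    have h1 : τ ((1 + ω) / algebraMap k K z) = ω⁻¹ * ((1 + ω) / algebraMap k K z) := by
      rw [map_div₀, hτ1, AlgEquiv.commutes, mul_div_assoc]
    rw [hroot _ hρ1, hj] at h1
    have h2 : ω ^ (2 * j) = ω := by
      have h3 : ω ^ j ≠ 0 := pow_ne_zero _ hω0
      field_simp at h1
      rw [mul_comm 2 j, pow_mul]
      exact h1.symm
    rcases Nat.eq_zero_or_pos j with hj1 | hj1
    · subst hj1
      exact hω1' (by simpa using h2.symm)
    · have h4 : ω ^ (2 * j - 1) = 1 := by
        apply mul_right_cancel₀ hω0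
        rw [← pow_succ, one_mul, show 2 * j - 1 + 1 = 2 * j by omega, h2]
      have h5 : Nat.Coprime (2 * j - 1) (2 ^ n) := by
        apply Nat.Coprime.pow_right
        rw [Nat.coprime_two_right]
        exact ⟨j - 1, by omega⟩
      have h6 := Nat.dvd_gcd (orderOf_dvd_of_pow_eq_one h4) (orderOf_dvd_of_pow_eq_one hω1)
      rw [h5, Nat.dvd_one, orderOf_eq_one_iff] at h6
      exact hω1' h6
  · intro x y hy0 hy
    obtain ⟨d, z, hz⟩ := gw_field (F := F) (K := K) 2 n Nat.prime_two ζ hζ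
      (by
        intro σ hσ
        have := hgen (σ.restrictScalars k) hσ
        ext a
        exact DFunLike.congr_fun this a)
      (by
        intro _ _ σ hσ
        have h1 : σ i = i := σ.commutes ⟨i, hiF⟩
        have h2 : σ i = -i := by
          rw [← hτi, hi, map_pow, map_pow, hσ, hτ]
        exact hii (h1.symm.trans h2)) (algebraMap k F x) y hy0 (by
          rw [hy]; rfl)
    obtain ⟨y1, hy1⟩ : ∃ y1, y1 = ζ ^ d * y := ⟨_, rfl⟩
    have hy1F : y1 ∈ F := by
      rw [hy1, ← hz]; exact z.2
    have hy10 : y1 ≠ 0 := by rw [hy1]; exact mul_ne_zero (pow_ne_zero _ hζ0) hy0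
    have hy1x : y1 ^ 2 ^ n = algebraMap k K x := by
      rw [hy1, mul_pow, ← pow_mul, mul_comm d, pow_mul, hζ.pow_eq_one, one_pow, one_mul, hy]
    obtain ⟨j, hj⟩ := hω (τ y1 / y1) (div_mem (hτF _ hy1F) hy1F) (by
      rw [div_pow, ← map_pow, hy1x, AlgEquiv.commutes, div_self]
      rw [← hy1x]; exact pow_ne_zero _ hy10)
    have hτy : τ y1 = ω ^ j * y1 := by rw [← hj, div_mul_cancel₀ _ hy10]
    have hpw : ∀ t : ℕ, (ω ^ t) ^ 2 ^ n = 1 := by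
      intro t; rw [← pow_mul, mul_comm, pow_mul, hω1, one_pow]
    rcases Nat.even_or_odd' j with ⟨t, ht | ht⟩
    · left
      obtain ⟨w, hw⟩ := hdesc (ω ^ t * y1) (mul_mem (pow_mem hωF _) hy1F) (by
        rw [map_mul, map_pow, hτω, hτy, ht, inv_pow]
        have := pow_ne_zero t hω0
        field_simp
        ring)
      refine ⟨w, (algebraMap k K).injective ?_⟩
      rw [map_pow, hw, mul_pow, hpw, one_mul, hy1x]
    · right
      obtain ⟨w, hw⟩ := hdesc (ω ^ (t + 1) * y1 / (1 + ω))
        (div_mem (mul_mem (pow_mem hωF _) hy1F) h1F) (by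
        rw [map_div₀, map_mul, map_pow, hτω, hτy, hτ1, ht, inv_pow]
        have := pow_ne_zero (t + 1) hω0
        field_simp
        try ring)
      refine ⟨w, (algebraMap k K).injective ?_⟩
      rw [map_mul, map_pow, hw, hx0, div_pow, div_mul_cancel₀ _ (pow_ne_zero _ h1ω), mul_pow, hpw,
        one_mul, hy1x]

theorem gw_cyclo (k : Type*) [Field k] [CharZero k] (m : ℕ) (hm : m ≠ 0) :
    IsCyclotomicExtension {m} k (cycloExt k m) := by
  have : NeZero m := ⟨hm⟩
  have h := IntermediateField.isCyclotomicExtension_adjoin_of_exists_isPrimitiveRoot {m} k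
    (AlgebraicClosure k) (by
      rintro a ha ha0
      rw [Set.mem_singleton_iff] at ha
      subst ha
      have : CharZero (AlgebraicClosure k) := charZero_of_injective_algebraMap
        (algebraMap k (AlgebraicClosure k)).injective
      exact (IsCyclotomicExtension.exists_isPrimitiveRoot (S := {a}) (AlgebraicClosure k)
        (AlgebraicClosure k) rfl ha0))
  have hs : {b : AlgebraicClosure k | ∃ n ∈ ({m} : Set ℕ), n ≠ 0 ∧ b ^ n = 1} =
      {x : AlgebraicClosure k | x ^ m = 1} := by
    ext b
    simp [hm]
  rw [hs] at h
  exact h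

theorem gw_ker_iff (k K : Type*) [Field k] [Field K] [Algebra k K] (m : ℕ) (x : kˣ) :
    (QuotientGroup.mk x : kˣ ⧸ (powMonoidHom m : kˣ →* kˣ).range) ∈ powQuotKernel k K m ↔
      ∃ y : Kˣ, (y : K) ^ m = algebraMap k K x := by
  rw [powQuotKernel, MonoidHom.mem_ker]
  change (QuotientGroup.mk (Units.map (algebraMap k K : k →+* K).toMonoidHom x) :
    Kˣ ⧸ (powMonoidHom m : Kˣ →* Kˣ).range) = 1 ↔ _
  rw [QuotientGroup.eq_one_iff]
  constructor
  · rintro ⟨y, hy⟩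
    exact ⟨y, congrArg Units.val hy⟩
  · rintro ⟨y, hy⟩
    exact ⟨y, Units.ext hy⟩

/-- Grunwald–Wang: if `(k, pⁿ)` is not the special case then
`H¹(k(μ_{pⁿ})/k, μ_{pⁿ}) = 0`, i.e. every element of `kˣ` which is a `pⁿ`-th power in
`k(μ_{pⁿ})` is a `pⁿ`-th power in `k`; in the special case this group has order exactly `2`. -/
theorem grunwald_wang_cohomology (k : Type*) [Field k] [CharZero k]
    (p n : ℕ) (hp : p.Prime) (hn : 1 ≤ n) :
    (¬IsSpecialCase k p n →
      ∀ x : kˣ, (∃ y : cycloExt k (p ^ n), y ^ p ^ n =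
          algebraMap k (cycloExt k (p ^ n)) (x : k)) →
        ∃ z : k, z ^ p ^ n = (x : k)) ∧
    (IsSpecialCase k 2 n →
      Nat.card (powQuotKernel k (cycloExt k (2 ^ n)) (2 ^ n)) = 2) := by
  have key : ∀ q : ℕ, q.Prime → FiniteDimensional k (cycloExt k (q ^ n)) ∧
      IsGalois k (cycloExt k (q ^ n)) ∧ ∃ ζ : cycloExt k (q ^ n), IsPrimitiveRoot ζ (q ^ n) ∧
      ∀ σ : cycloExt k (q ^ n) ≃ₐ[k] cycloExt k (q ^ n), σ ζ = ζ → σ = 1 := by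
    intro q hq
    have hq0 : q ^ n ≠ 0 := (pow_pos hq.pos n).ne'
    have : NeZero (q ^ n) := ⟨hq0⟩
    have hc := gw_cyclo k (q ^ n) hq0
    refine ⟨IsCyclotomicExtension.finiteDimensional {q ^ n} k _,
      IsCyclotomicExtension.isGalois {q ^ n} k _, ?_⟩
    have hζ := IsCyclotomicExtension.zeta_spec (q ^ n) k (cycloExt k (q ^ n))
    refine ⟨_, hζ, ?_⟩
    intro σ hσ
    have h : σ.toAlgHom = (1 : cycloExt k (q ^ n) ≃ₐ[k] cycloExt k (q ^ n)).toAlgHom := by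
      apply (hζ.powerBasis k).algHom_ext
      rw [IsPrimitiveRoot.powerBasis_gen]
      exact hσ
    ext a
    exact congrArg Subtype.val (DFunLike.congr_fun h a)
  constructor
  · rintro hns x ⟨y, hy⟩
    obtain ⟨_, _, ζ, hζ, hgen⟩ := key p hp
    have hy0 : y ≠ 0 := by
      rintro rfl
      rw [zero_pow (pow_pos hp.pos n).ne'] at hy
      exact x.ne_zero ((map_eq_zero _).1 hy.symm)
    obtain ⟨d, z, hz⟩ := gw_field p n hp ζ hζ hgen (by
      intro h2 hn2 σ hσ
      subst h2
      refine hns ⟨rfl, hn2, σ, ?_⟩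
      intro ξ hξ
      have : NeZero (2 ^ n) := ⟨by positivity⟩
      obtain ⟨j, -, rfl⟩ := hζ.eq_pow_of_pow_eq_one hξ
      rw [map_pow, hσ, inv_pow]) (x : k) y hy0 hy
    refine ⟨z, (algebraMap k (cycloExt k (p ^ n))).injective ?_⟩
    rw [map_pow, hz, mul_pow, ← pow_mul, mul_comm d, pow_mul, hζ.pow_eq_one, one_pow, one_mul, hy]
  · rintro ⟨-, hn2, τ, hτ⟩
    obtain ⟨_, _, ζ, hζ, hgen⟩ := key 2 Nat.prime_two
    obtain ⟨y0, x0, hy0, hx0, hnp, hall⟩ := gw_special n hn2 ζ hζ hgen τ (hτ ζ hζ.pow_eq_one)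
    have hx00 : x0 ≠ 0 := by
      rintro rfl
      rw [map_zero] at hx0
      exact pow_ne_zero _ hy0 hx0
    rw [Nat.card_eq_two_iff]
    refine ⟨1, ⟨QuotientGroup.mk (Units.mk0 x0 hx00), ?_⟩, ?_, ?_⟩
    · rw [gw_ker_iff]
      exact ⟨Units.mk0 y0 hy0, hx0⟩
    · intro h
      have h1 := congrArg Subtype.val h
      have h2 := (QuotientGroup.eq_one_iff _).1 h1.symm
      obtain ⟨z, hz⟩ := h2
      exact hnp ⟨z, congrArg Units.val hz⟩
    · rw [Set.eq_univ_iff_forall]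
      rintro ⟨q, hq⟩
      induction q using QuotientGroup.induction_on with
      | H x =>
      obtain ⟨y, hy⟩ := (gw_ker_iff _ _ _ _).1 hq
      rcases hall x y y.ne_zero hy with ⟨z, hz⟩ | ⟨z, hz⟩
      · left
        have hz0 : z ≠ 0 := by
          rintro rfl
          rw [zero_pow (by positivity)] at hz
          exact x.ne_zero hz.symm
        apply Subtype.ext
        exact (QuotientGroup.eq_one_iff _).2 ⟨Units.mk0 z hz0, Units.ext hz⟩
      · right
        have hz0 : z ≠ 0 := by
          rintro rfl
          rw [zero_pow (by positivity), zero_mul] at hz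
          exact x.ne_zero hz.symm
        rw [Set.mem_singleton_iff]
        apply Subtype.ext
        change (QuotientGroup.mk x : kˣ ⧸ (powMonoidHom (2 ^ n) : kˣ →* kˣ).range) =
          QuotientGroup.mk (Units.mk0 x0 hx00)
        symm
        rw [QuotientGroup.eq]
        refine ⟨Units.mk0 z hz0, ?_⟩
        rw [eq_inv_mul_iff_mul_eq]
        apply Units.ext
        change x0 * z ^ 2 ^ n = x
        rw [mul_comm, hz]
end

section
/- Let p be a prime, n ≥ 1, let k be a field of characteristic 0, and let K/k be a finite abelian Galois extension such that K contains a primitive pⁿ-th root of unity. Assume (k, pⁿ) is not the special case. Then there is a group isomorphism between the kernel of the natural map kˣ/kˣ^{pⁿ} → Kˣ/Kˣ^{pⁿ} and the group Hom(Gal(K/k(μ_{pⁿ})), μ_{pⁿ}(k)) of group homomorphisms from the Galois group of K over k(μ_{pⁿ}) to the group of pⁿ-th roots of unity contained in k. -/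
/-- order computation from valuation growth -/
lemma aux_core (p n : ℕ) (hp : p.Prime) (u : (ZMod (p ^ n))ˣ) (hu1 : u ≠ 1) (U : ℕ) (hU1 : 1 < U)
    (hU : (U : ZMod (p ^ n)) = u) (c : ℕ) (hc : c < n)
    (h : ∀ j, 1 ≤ j → padicValNat p (U ^ (p ^ j) - 1) = c + j) :
    padicValNat p (U ^ (orderOf u) - 1) = n := by
  have := Fact.mk hp
  have key : ∀ e, 0 < e → (u ^ e = 1 ↔ n ≤ padicValNat p (U ^ e - 1)) := by
    intro e he
    have h1 : 1 < U ^ e := Nat.one_lt_pow he.ne' hU1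
    rw [← padicValNat_dvd_iff_le (by omega), ← ZMod.natCast_eq_zero_iff, Nat.cast_sub h1.le,
      Nat.cast_pow, hU, Nat.cast_one, sub_eq_zero, ← Units.val_pow_eq_pow_val, Units.val_eq_one]
  have h1 : u ^ (p ^ (n - c)) = 1 := by
    rw [key _ (pow_pos hp.pos _), h _ (by omega)]; omega
  obtain ⟨j, hj, hD⟩ := (Nat.dvd_prime_pow hp).1 (orderOf_dvd_of_pow_eq_one h1)
  have hj0 : 1 ≤ j := by
    rcases Nat.eq_zero_or_pos j with h0 | h0
    · rw [h0, pow_zero, orderOf_eq_one_iff] at hD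
      exact absurd hD hu1
    · exact h0
  have h2 := (key _ (pow_pos hp.pos j)).1 (by rw [← hD]; exact pow_orderOf_eq_one u)
  rw [hD]
  rw [h j hj0] at h2 ⊢
  omega

lemma aux_val (p n : ℕ) (hp : p.Prime) (u : (ZMod (p ^ n))ˣ) (hu1 : u ≠ 1)
    (hu : p = 2 → u ≠ -1) (U : ℕ) (hU1 : 1 < U)
    (hU : (U : ZMod (p ^ n)) = u) (hd : p ∣ U - 1) :
    padicValNat p (U ^ (orderOf u) - 1) = n := by
  have := Fact.mk hp
  have hpU : ¬ p ∣ U := by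
    intro h
    have := (Nat.dvd_sub_iff_right hU1.le h).1 hd
    exact hp.one_lt.ne' (Nat.dvd_one.1 this)
  have ha : padicValNat p (U - 1) < n := by
    by_contra! hcon
    rw [← padicValNat_dvd_iff_le (by omega), ← ZMod.natCast_eq_zero_iff, Nat.cast_sub hU1.le,
      hU, Nat.cast_one, sub_eq_zero, Units.val_eq_one] at hcon
    exact hu1 hcon
  rcases hp.eq_two_or_odd' with rfl | hodd
  · have hb : padicValNat 2 (U + 1) < n := by
      by_contra! hcon
      rw [← padicValNat_dvd_iff_le (by omega), ← ZMod.natCast_eq_zero_iff, Nat.cast_add,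
        hU, Nat.cast_one, add_eq_zero_iff_eq_neg] at hcon
      exact hu rfl (Units.ext (by simpa using hcon))
    have ha1 : 1 ≤ padicValNat 2 (U - 1) := by
      rw [← padicValNat_dvd_iff_le (by omega)]; simpa using hd
    have hb1 : 1 ≤ padicValNat 2 (U + 1) := by
      rw [← padicValNat_dvd_iff_le (by omega)]; omega
    have hmin : padicValNat 2 (U - 1) ≤ 1 ∨ padicValNat 2 (U + 1) ≤ 1 := by
      by_contra! hcon
      obtain ⟨h1, h2⟩ := hcon
      have h1 : 2 ≤ padicValNat 2 (U - 1) := h1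
      have h2 : 2 ≤ padicValNat 2 (U + 1) := h2
      rw [← padicValNat_dvd_iff_le (by omega)] at h1 h2
      omega
    refine aux_core 2 n hp u hu1 U hU1 hU (padicValNat 2 (U + 1) + padicValNat 2 (U - 1) - 1)
      (by omega) ?_
    intro j hj
    have := padicValNat.pow_two_sub_one (n := 2 ^ j) hU1 hpU (by positivity)
      ((Nat.even_pow.2 ⟨even_two, by omega⟩))
    rw [padicValNat.prime_pow] at this
    omega
  · refine aux_core p n hp u hu1 U hU1 hU (padicValNat p (U - 1)) ha ?_
    intro j hj
    have := padicValNat.pow_sub_pow (p := p) hodd (x := U) (y := 1) hU1 hd hpU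
      (n := p ^ j) (pow_pos hp.pos j).ne'
    rwa [one_pow, padicValNat.prime_pow] at this

lemma aux_factor (p n : ℕ) (hp : p.Prime) (x : ℕ) (hx : x ≠ 0) :
    ∃ s : (ZMod (p ^ n))ˣ, (x : ZMod (p ^ n)) = (p : ZMod (p ^ n)) ^ padicValNat p x * s := by
  have := Fact.mk hp
  obtain ⟨y, hy⟩ := pow_padicValNat_dvd (p := p) (n := x)
  have hyp : ¬ p ∣ y := by
    rintro ⟨z, rfl⟩
    have : p ^ (padicValNat p x + 1) ∣ x := ⟨z, by rw [pow_succ, mul_assoc, ← hy]⟩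
    exact pow_succ_padicValNat_not_dvd hx this
  have hc : y.Coprime (p ^ n) :=
    Nat.Coprime.pow_right n ((Nat.Prime.coprime_iff_not_dvd hp).2 hyp).symm
  refine ⟨ZMod.unitOfCoprime y hc, ?_⟩
  rw [ZMod.coe_unitOfCoprime]
  conv_lhs => rw [hy]
  push_cast
  rfl

lemma aux_shape (p n : ℕ) (hp : p.Prime) (u : (ZMod (p ^ n))ˣ)
    (hu : p = 2 → 2 ≤ n → u ≠ -1) :
    ∃ (a b : ℕ) (s t : (ZMod (p ^ n))ˣ), a + b = n ∧
      (u : ZMod (p ^ n)) - 1 = (p : ZMod (p ^ n)) ^ a * s ∧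
      ∑ i ∈ Finset.range (orderOf u), (u : ZMod (p ^ n)) ^ i = (p : ZMod (p ^ n)) ^ b * t := by
  have := Fact.mk hp
  have hpn : (p : ZMod (p ^ n)) ^ n = 0 := by
    rw [← Nat.cast_pow, ZMod.natCast_self]
  by_cases hu1 : u = 1
  · subst hu1
    exact ⟨n, 0, 1, 1, by simp, by simp [hpn], by simp⟩
  have hn : n ≠ 0 := by
    rintro rfl
    apply hu1
    have : Subsingleton (ZMod (p ^ 0)) := by rw [pow_zero]; infer_instance
    exact Subsingleton.elim _ _
  set U : ℕ := (u : ZMod (p ^ n)).val + p ^ n with hUdef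
  have hU : (U : ZMod (p ^ n)) = u := by
    have : NeZero (p ^ n) := ⟨(pow_pos hp.pos n).ne'⟩
    rw [hUdef, Nat.cast_add, ZMod.natCast_self, add_zero, ZMod.natCast_zmod_val]
  have hU1 : 1 < U := lt_of_lt_of_le (Nat.one_lt_pow hn hp.one_lt) (Nat.le_add_left _ _)
  have hu' : p = 2 → u ≠ -1 := by
    intro h2
    by_cases h : 2 ≤ n
    · exact hu h2 h
    · have : n = 1 := by omega
      subst this; subst h2
      intro h; apply hu1; rw [h]; decide
  by_cases hd : p ∣ U - 1
  · have hv := aux_val p n hp u hu1 hu' U hU1 hU hd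
    have hD : 0 < orderOf u := orderOf_pos u
    have hmul : (∑ i ∈ Finset.range (orderOf u), U ^ i) * (U - 1) = U ^ orderOf u - 1 := by
      rw [Nat.geomSum_eq hU1, Nat.div_mul_cancel]
      simpa using Nat.sub_dvd_pow_sub_pow U 1 (orderOf u)
    have hS0 : (∑ i ∈ Finset.range (orderOf u), U ^ i) ≠ 0 := by
      intro h0
      rw [h0, zero_mul] at hmul
      have := Nat.one_lt_pow hD.ne' hU1
      omega
    rw [← hmul, padicValNat.mul hS0 (by omega)] at hv
    obtain ⟨s, hs⟩ := aux_factor p n hp (U - 1) (by omega)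
    obtain ⟨t, ht⟩ := aux_factor p n hp _ hS0
    refine ⟨_, _, s, t, by rw [add_comm]; exact hv, ?_, ?_⟩
    · rw [← hs, Nat.cast_sub hU1.le, hU, Nat.cast_one]
    · rw [← ht]; push_cast; rw [hU]
  · have hv : padicValNat p (U - 1) = 0 := padicValNat.eq_zero_of_not_dvd hd
    obtain ⟨s, hs⟩ := aux_factor p n hp (U - 1) (by omega)
    rw [hv, Nat.cast_sub hU1.le, hU, Nat.cast_one] at hs
    refine ⟨0, n, s, 1, by simp, hs, ?_⟩
    rw [hpn, zero_mul]
    have := geom_sum_mul (u : ZMod (p ^ n)) (orderOf u)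
    rw [← Units.val_pow_eq_pow_val, pow_orderOf_eq_one, Units.val_one, sub_self, hs, pow_zero,
      one_mul] at this
    exact (Units.mul_left_eq_zero s).1 this

lemma aux_div (p n a b : ℕ) (hp : p.Prime) (hab : a + b = n) (s t : (ZMod (p ^ n))ˣ)
    (x : ZMod (p ^ n)) (hx : (p : ZMod (p ^ n)) ^ b * t * x = 0) :
    ∃ y, x = (p : ZMod (p ^ n)) ^ a * s * y := by
  have : NeZero (p ^ n) := ⟨(pow_pos hp.pos n).ne'⟩
  have h1 : (p : ZMod (p ^ n)) ^ b * x = 0 := by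
    rw [mul_right_comm] at hx
    exact (Units.mul_left_eq_zero t).1 hx
  rw [← ZMod.natCast_zmod_val x, ← Nat.cast_pow, ← Nat.cast_mul, ZMod.natCast_eq_zero_iff]
    at h1
  have hpp : p ^ n = p ^ b * p ^ a := by rw [← hab, pow_add, mul_comm]
  have h1 : p ^ b * p ^ a ∣ p ^ b * x.val := by rwa [← hpp]
  obtain ⟨y, hy⟩ := Nat.dvd_of_mul_dvd_mul_left (pow_pos hp.pos b) h1
  refine ⟨(s⁻¹ : (ZMod (p ^ n))ˣ) * y, ?_⟩
  rw [mul_assoc, Units.mul_inv_cancel_left]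
  have : x = ((x.val : ℕ) : ZMod (p ^ n)) := (ZMod.natCast_zmod_val x).symm
  rw [this, hy]; push_cast; rfl

/-- `Ĥ⁻¹` vanishing. -/
lemma aux_A (p n : ℕ) (hp : p.Prime) (u : (ZMod (p ^ n))ˣ)
    (hu : p = 2 → 2 ≤ n → u ≠ -1) (x : ZMod (p ^ n))
    (hx : (∑ i ∈ Finset.range (orderOf u), (u : ZMod (p ^ n)) ^ i) * x = 0) :
    ∃ y, x = ((u : ZMod (p ^ n)) - 1) * y := by
  obtain ⟨a, b, s, t, hab, h1, h2⟩ := aux_shape p n hp u hu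
  rw [h2] at hx
  rw [h1]
  exact aux_div p n a b hp hab s t x hx

/-- `Ĥ⁰` vanishing. -/
lemma aux_B (p n : ℕ) (hp : p.Prime) (u : (ZMod (p ^ n))ˣ)
    (hu : p = 2 → 2 ≤ n → u ≠ -1) (x : ZMod (p ^ n))
    (hx : ((u : ZMod (p ^ n)) - 1) * x = 0) :
    ∃ y, x = (∑ i ∈ Finset.range (orderOf u), (u : ZMod (p ^ n)) ^ i) * y := by
  obtain ⟨a, b, s, t, hab, h1, h2⟩ := aux_shape p n hp u hu
  rw [h1] at hx
  rw [h2]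
  exact aux_div p n b a hp (by omega) t s x hx

lemma aux_cyclic_two (m : ℕ) (R : Subgroup (ZMod (2 ^ (m + 2)))ˣ) (hR : -1 ∉ R) : IsCyclic R := by
  have : NeZero (2 ^ (m + 2)) := ⟨by positivity⟩
  have hz : ∀ x ∈ Subgroup.zpowers (-1 : (ZMod (2 ^ (m + 2)))ˣ), x = 1 ∨ x = -1 := by
    rintro x ⟨i, rfl⟩
    rcases Int.even_or_odd i with h | h
    · left; exact h.neg_one_zpow
    · right; exact h.neg_one_zpow
  have h4 : (4 : ℕ) ∣ 2 ^ (m + 2) := ⟨2 ^ m, by ring⟩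
  let r : (ZMod (2 ^ (m + 2)))ˣ →* (ZMod 4)ˣ := Units.map (ZMod.castHom h4 (ZMod 4)).toMonoidHom
  have hne : (1 : (ZMod (2 ^ (m + 2)))ˣ) ≠ -1 := by
    intro h
    have := congrArg (fun x => ((r x : (ZMod 4)ˣ) : ZMod 4)) h
    simp [r] at this
    revert this; decide
  let q := QuotientGroup.mk' (Subgroup.zpowers (-1 : (ZMod (2 ^ (m + 2)))ˣ))
  have hc5 : Nat.Coprime 5 (2 ^ (m + 2)) := Nat.Coprime.pow_right _ (by decide)
  let v := ZMod.unitOfCoprime 5 hc5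
  have hv : orderOf v = 2 ^ m := by
    rw [← orderOf_units, ZMod.coe_unitOfCoprime]
    exact_mod_cast ZMod.orderOf_five m
  have hrv : r v = 1 := by
    apply Units.ext
    change (ZMod.castHom h4 (ZMod 4)) (v : ZMod (2 ^ (m + 2))) = 1
    rw [ZMod.coe_unitOfCoprime, map_natCast]
    decide
  have hq : 2 ^ m ∣ orderOf (q v) := by
    rw [← hv]
    apply orderOf_dvd_of_pow_eq_one
    have h1 : q (v ^ orderOf (q v)) = 1 := by rw [map_pow, pow_orderOf_eq_one]
    have h2 : v ^ orderOf (q v) ∈ Subgroup.zpowers (-1 : (ZMod (2 ^ (m + 2)))ˣ) := by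
      rwa [← QuotientGroup.eq_one_iff]
    rcases hz _ h2 with h | h
    · exact h
    · exfalso
      have := congrArg r h
      rw [map_pow, hrv, one_pow] at this
      have := congrArg (fun x : (ZMod 4)ˣ => (x : ZMod 4)) this
      simp [r] at this
      revert this; decide
  have hord2 : orderOf (-1 : (ZMod (2 ^ (m + 2)))ˣ) = 2 :=
    orderOf_eq_prime (by simp) hne.symm
  have hcard : Nat.card ((ZMod (2 ^ (m + 2)))ˣ ⧸ Subgroup.zpowers (-1 : (ZMod (2 ^ (m + 2)))ˣ))
      = 2 ^ m := by
    have h1 := Subgroup.card_eq_card_quotient_mul_card_subgroup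
      (Subgroup.zpowers (-1 : (ZMod (2 ^ (m + 2)))ˣ))
    rw [Nat.card_zpowers, hord2, Nat.card_eq_fintype_card, ZMod.card_units_eq_totient,
      Nat.totient_prime_pow Nat.prime_two (by omega)] at h1
    have : 2 ^ (m + 2 - 1) = 2 ^ m * 2 := by rw [← pow_succ]; rfl
    omega
  have hcyc : IsCyclic ((ZMod (2 ^ (m + 2)))ˣ ⧸ Subgroup.zpowers (-1 : (ZMod (2 ^ (m + 2)))ˣ)) := by
    refine isCyclic_of_orderOf_eq_card (q v) (Nat.dvd_antisymm ?_ ?_)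
    · exact orderOf_dvd_natCard _
    · rw [hcard]; exact hq
  refine isCyclic_of_injective (q.comp R.subtype) ?_
  rw [injective_iff_map_eq_one]
  intro x hx
  have h2 : (x : (ZMod (2 ^ (m + 2)))ˣ) ∈ Subgroup.zpowers (-1 : (ZMod (2 ^ (m + 2)))ˣ) := by
    rwa [← QuotientGroup.eq_one_iff]
  rcases hz _ h2 with h | h
  · exact Subtype.ext h
  · exact absurd (h ▸ x.2) hR

lemma aux_cyclic (p n : ℕ) (hp : p.Prime) (R : Subgroup (ZMod (p ^ n))ˣ)
    (hR : p = 2 → 2 ≤ n → -1 ∉ R) : IsCyclic R := by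
  by_cases h2 : p = 2
  · subst h2
    by_cases hn : 2 ≤ n
    · obtain ⟨m, rfl⟩ := Nat.exists_eq_add_of_le' hn
      exact aux_cyclic_two m R (hR rfl hn)
    · have : IsCyclic (ZMod (2 ^ n))ˣ := (ZMod.isCyclic_units_two_pow_iff n).2 (by omega)
      infer_instance
  · have := ZMod.isCyclic_units_of_prime_pow p hp h2 n
    infer_instance

lemma aux_extend {G : Type*} [Group G] (hG : ∀ a b : G, a * b = b * a) {m : ℕ}
    (χ : G →* (ZMod m)ˣ) (σ : G)
    (hσ : ∀ g, ∃ i : ℕ, χ g = χ σ ^ i)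
    (hB : ∀ x : ZMod m, ((χ σ : ZMod m) - 1) * x = 0 →
      ∃ y, x = (∑ i ∈ Finset.range (orderOf (χ σ)), (χ σ : ZMod m) ^ i) * y)
    (f : G → ZMod m)
    (hf : ∀ g h, χ g = 1 → χ h = 1 → f (g * h) = f g + f h)
    (hfix : ∀ g h, χ h = 1 → (χ g : ZMod m) * f h = f h) :
    ∃ c : G → ZMod m, (∀ g h, c (g * h) = χ g * c h + c g) ∧ ∀ h, χ h = 1 → c h = f h := by
  set u := χ σ with hu
  set d := orderOf u with hd
  have hχd : χ (σ ^ d) = 1 := by rw [map_pow, ← hu, hd, pow_orderOf_eq_one]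
  obtain ⟨x, hx⟩ := hB (f (σ ^ d)) (by rw [sub_mul, one_mul, hu, hfix _ _ hχd, sub_self])
  let S : ℕ → ZMod m := fun i => ∑ j ∈ Finset.range i, (u : ZMod m) ^ j
  have hS : ∀ i j, S (i + j) = S i + (u : ZMod m) ^ i * S j := by
    intro i j
    simp only [S]
    rw [Finset.sum_range_add, Finset.mul_sum]
    simp [pow_add]
  let T : ℕ → G → ZMod m := fun i g => S i * x + f ((σ ^ i)⁻¹ * g)
  have hker : ∀ i g, χ g = u ^ i → χ ((σ ^ i)⁻¹ * g) = 1 := by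
    intro i g h
    rw [map_mul, map_inv, map_pow, h, inv_mul_cancel]
  have hud : u ^ d = 1 := pow_orderOf_eq_one u
  have hT1 : ∀ i g, χ g = u ^ i → T (i + d) g = T i g := by
    intro i g h
    have e1 : (u : ZMod m) ^ i * f (σ ^ d) = f (σ ^ d) := by
      have := hfix (σ ^ i) _ hχd
      rwa [map_pow, Units.val_pow_eq_pow_val] at this
    have e2 : (σ ^ i)⁻¹ * g = σ ^ d * ((σ ^ (i + d))⁻¹ * g) := by
      rw [pow_add, mul_inv_rev]; group
    have h' : χ g = u ^ (i + d) := by rw [pow_add, hud, mul_one, h]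
    have e3 : f ((σ ^ i)⁻¹ * g) = f (σ ^ d) + f ((σ ^ (i + d))⁻¹ * g) := by
      rw [e2, hf _ _ hχd (hker _ _ h')]
    have e4 : S d * x = f (σ ^ d) := hx.symm
    simp only [T]
    rw [hS, e3, add_mul, mul_assoc, e4, e1, add_assoc]
  have hT2 : ∀ t i g, χ g = u ^ i → T (i + d * t) g = T i g := by
    intro t
    induction t with
    | zero => intro i g _; simp
    | succ t ih =>
      intro i g h
      rw [Nat.mul_succ, ← add_assoc, hT1, ih i g h]
      rw [pow_add, pow_mul, hud, one_pow, mul_one, h]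
  have hT3 : ∀ i j g, χ g = u ^ i → χ g = u ^ j → T i g = T j g := by
    intro i j g hi hj
    have hm : i % d = j % d := pow_inj_mod.1 (hi.symm.trans hj)
    have k : ∀ i, χ g = u ^ i → T i g = T (i % d) g := by
      intro i hi
      conv_lhs => rw [← Nat.mod_add_div i d]
      apply hT2
      rw [hi]
      exact (pow_mod_orderOf u i).symm
    rw [k i hi, k j hj, hm]
  choose I hI using hσ
  refine ⟨fun g => T (I g) g, ?_, ?_⟩
  · intro g h
    have h1 : χ (g * h) = u ^ (I g + I h) := by rw [map_mul, hI, hI, pow_add]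
    have h2 : T (I (g * h)) (g * h) = T (I g + I h) (g * h) := hT3 _ _ _ (hI _) h1
    have e2 : (σ ^ (I g + I h))⁻¹ * (g * h) = ((σ ^ (I g))⁻¹ * g) * ((σ ^ (I h))⁻¹ * h) := by
      rw [pow_add, mul_inv_rev, hG (σ ^ (I h))⁻¹, mul_assoc, mul_assoc, ← mul_assoc _ g,
        hG _ g, mul_assoc]
    have e3 := hfix g _ (hker _ _ (hI h))
    have e4 : (χ g : ZMod m) = (u : ZMod m) ^ I g := by
      rw [hI g, Units.val_pow_eq_pow_val]
    change T (I (g * h)) (g * h) = χ g * T (I h) h + T (I g) g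
    rw [h2]
    simp only [T]
    rw [e2, hf _ _ (hker _ _ (hI g)) (hker _ _ (hI h)), hS, mul_add, e3, e4]
    ring
  · intro h hh
    change T (I h) h = f h
    rw [hT3 (I h) 0 h (hI h) (by rw [hh, pow_zero])]
    simp [T, S]

lemma aux_special (k K : Type*) [Field k] [Field K] [Algebra k K] [Algebra.IsAlgebraic k K]
    (n : ℕ) (hn : 2 ≤ n) (ζ : K) (hζ : IsPrimitiveRoot ζ (2 ^ n)) (g : K ≃ₐ[k] K)
    (hg : g ζ = ζ⁻¹) : IsSpecialCase k 2 n := by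
  refine ⟨rfl, hn, ?_⟩
  have hpos : 0 < 2 ^ n := by positivity
  have : NeZero (2 ^ n) := ⟨hpos.ne'⟩
  let j : K →ₐ[k] AlgebraicClosure k := IsAlgClosed.lift
  let _ : Algebra K (AlgebraicClosure k) := j.toRingHom.toAlgebra
  have : IsScalarTower k K (AlgebraicClosure k) := IsScalarTower.of_algebraMap_eq' j.comp_algebraMap.symm
  let τ := g.liftNormal (AlgebraicClosure k)
  have hj : IsPrimitiveRoot (j ζ) (2 ^ n) := hζ.map_of_injective j.injective
  have hτζ : τ (j ζ) = (j ζ)⁻¹ := by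
    have : τ (j ζ) = j (g ζ) := g.liftNormal_commutes (AlgebraicClosure k) ζ
    rw [this, hg, map_inv₀]
  have hτ : ∀ x : AlgebraicClosure k, x ^ 2 ^ n = 1 → τ x = x⁻¹ := by
    intro x hx
    obtain ⟨i, -, rfl⟩ := hj.eq_pow_of_pow_eq_one hx
    rw [map_pow, hτζ, inv_pow]
  have hmap : (cycloExt k (2 ^ n)).map τ.toAlgHom = cycloExt k (2 ^ n) := by
    rw [cycloExt, IntermediateField.adjoin_map]
    congr 1
    ext x
    constructor
    · rintro ⟨y, hy, rfl⟩
      change (τ y) ^ 2 ^ n = 1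
      rw [← map_pow, hy, map_one]
    · intro hx
      refine ⟨x⁻¹, ?_, ?_⟩
      · change x⁻¹ ^ 2 ^ n = 1
        rw [inv_pow, hx, inv_one]
      · change τ x⁻¹ = x
        rw [map_inv₀, hτ x hx, inv_inv]
  refine ⟨(IntermediateField.intermediateFieldMap τ (cycloExt k (2 ^ n))).trans
    (IntermediateField.equivOfEq hmap), ?_⟩
  intro z hz
  apply Subtype.ext
  change τ (z : AlgebraicClosure k) = _
  rw [hτ _ (by exact_mod_cast congrArg Subtype.val hz)]
  rfl

lemma aux_iso {P A B : Type*} [Group P] [Group A] [Group B] (φ : P →* A) (ψ : P →* B)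
    (hφ : Function.Surjective φ) (hψ : Function.Surjective ψ) (h : φ.ker = ψ.ker) :
    Nonempty (A ≃* B) :=
  ⟨(QuotientGroup.quotientKerEquivOfSurjective φ hφ).symm.trans
    ((QuotientGroup.quotientMulEquivOfEq h).trans
      (QuotientGroup.quotientKerEquivOfSurjective ψ hψ))⟩

/-- For a finite abelian Galois extension `K/k` of characteristic-zero fields with `μ_{pⁿ} ⊆ K`,
if `(k, pⁿ)` is not the special case, then the kernel `H¹(K/k, μ_{pⁿ})` of
`kˣ/kˣ^{pⁿ} → Kˣ/Kˣ^{pⁿ}` is isomorphic to `Hom(Gal(K/k(μ_{pⁿ})), μ_{pⁿ}(k))`. -/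
theorem powQuotKernel_iso_hom (k K : Type*) [Field k] [CharZero k] [Field K]
    [Algebra k K] [FiniteDimensional k K] [IsGalois k K]
    (habelian : ∀ σ τ : K ≃ₐ[k] K, σ * τ = τ * σ)
    (p n : ℕ) (hp : p.Prime) (hn : 1 ≤ n)
    (hζ : ∃ ζ : K, IsPrimitiveRoot ζ (p ^ n))
    (hns : ¬IsSpecialCase k p n) :
    Nonempty (powQuotKernel k K (p ^ n) ≃*
      ((K ≃ₐ[↥(IntermediateField.adjoin k {x : K | x ^ p ^ n = 1})] K) →*
        rootsOfUnity (p ^ n) k)) := by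
  obtain ⟨ζ, hζ⟩ := hζ
  have hm0 : 0 < p ^ n := pow_pos hp.pos n
  have : NeZero (p ^ n) := ⟨hm0.ne'⟩
  have hshape := aux_A p n hp
  have hshapeB := aux_B p n hp
  have hcycl := aux_cyclic p n hp
  set χ : (K ≃ₐ[k] K) →* (ZMod (p ^ n))ˣ := hζ.autToPow k with hχ
  set F := IntermediateField.adjoin k {x : K | x ^ p ^ n = 1} with hF
  -- the exponential `ZMod (p ^ n) → K`
  let E : ZMod (p ^ n) → K := fun x => ζ ^ x.val
  have hEnat : ∀ i : ℕ, E (i : ZMod (p ^ n)) = ζ ^ i := by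
    intro i
    simp only [E]
    rw [ZMod.val_natCast]
    nth_rewrite 1 [hζ.eq_orderOf]
    exact pow_mod_orderOf ζ i
  have hE0 : E 0 = 1 := by simpa using hEnat 0
  have hE1 : E 1 = ζ := by simpa using hEnat 1
  have hEadd : ∀ x y, E (x + y) = E x * E y := by
    intro x y
    have : x + y = ((x.val + y.val : ℕ) : ZMod (p ^ n)) := by
      rw [Nat.cast_add, ZMod.natCast_zmod_val, ZMod.natCast_zmod_val]
    rw [this, hEnat, pow_add]
  have hEg : ∀ (g : K ≃ₐ[k] K) x, g (E x) = E (χ g * x) := by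
    intro g x
    have : (χ g : ZMod (p ^ n)) * x = (((χ g : ZMod (p ^ n)).val * x.val : ℕ) : ZMod (p ^ n)) := by
      rw [Nat.cast_mul, ZMod.natCast_zmod_val, ZMod.natCast_zmod_val]
    rw [this, hEnat, pow_mul, hχ, hζ.autToPow_spec k g]
    simp only [E]
    rw [map_pow]
  have hEinj : ∀ x y, E x = E y → x = y := by
    intro x y h
    exact ZMod.val_injective _ (hζ.pow_inj (ZMod.val_lt _) (ZMod.val_lt _) h)
  have hEsurj : ∀ y : K, y ^ p ^ n = 1 → ∃ x, y = E x := by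
    intro y hy
    obtain ⟨i, -, rfl⟩ := hζ.eq_pow_of_pow_eq_one hy
    exact ⟨i, (hEnat i).symm⟩
  have hEm : ∀ x, E x ^ p ^ n = 1 := by
    intro x
    simp only [E]
    rw [← pow_mul, mul_comm, pow_mul, hζ.pow_eq_one, one_pow]
  have hEne : ∀ x, E x ≠ 0 := by
    intro x h
    have := hEm x
    rw [h, zero_pow hm0.ne'] at this
    exact zero_ne_one this
  have hspec : p = 2 → 2 ≤ n → ∀ g, χ g ≠ -1 := by
    intro h2 hn2 g hg
    apply hns
    subst h2
    refine aux_special k K n hn2 ζ hζ g ?_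
    have h1 := hEg g 1
    rw [hE1, hg, mul_one] at h1
    rw [h1]
    apply eq_inv_of_mul_eq_one_left
    nth_rewrite 1 [← hE1]
    rw [← hEadd, ← hE0]
    simp
  -- generator
  obtain ⟨σ, hσ⟩ : ∃ σ, ∀ g, ∃ i : ℕ, χ g = χ σ ^ i := by
    have : IsCyclic χ.range := hcycl χ.range (by
      rintro h2 hn2 ⟨g, hg⟩
      exact hspec h2 hn2 g hg)
    obtain ⟨⟨w, ⟨σ, rfl⟩⟩, hw⟩ := IsCyclic.exists_monoid_generator (α := χ.range)
    refine ⟨σ, fun g => ?_⟩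
    obtain ⟨i, hi⟩ := hw ⟨χ g, ⟨g, rfl⟩⟩
    exact ⟨i, (congrArg Subtype.val hi).symm⟩
  -- Galois group over `F` versus kernel of `χ`
  have hτE : ∀ (τ : K ≃ₐ[F] K) x, τ (E x) = E x := by
    intro τ x
    have hmem : E x ∈ F := IntermediateField.subset_adjoin k _ (hEm x)
    exact τ.commutes ⟨E x, hmem⟩
  have hχτ : ∀ τ : K ≃ₐ[F] K, χ (τ.restrictScalars k) = 1 := by
    intro τ
    apply Units.ext
    apply hEinj
    have h1 := hEg (τ.restrictScalars k) 1
    rw [mul_one] at h1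
    rw [← h1, Units.val_one]
    exact hτE τ 1
  have hlift : ∀ g : K ≃ₐ[k] K, χ g = 1 → ∃ τ : K ≃ₐ[F] K, ∀ x, τ x = g x := by
    intro g hg
    have hgF : g ∈ F.fixingSubgroup := by
      have hle : F ≤ IntermediateField.fixedField (Subgroup.zpowers g) := by
        rw [hF, IntermediateField.adjoin_le_iff]
        intro y hy
        obtain ⟨x, rfl⟩ := hEsurj y hy
        have hfix : g (E x) = E x := by rw [hEg, hg, Units.val_one, one_mul]
        change E x ∈ IntermediateField.fixedField (Subgroup.zpowers g)
        rw [IntermediateField.mem_fixedField_iff]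
        intro h hh
        have : Subgroup.zpowers g ≤ MulAction.stabilizer (K ≃ₐ[k] K) (E x) := by
          rw [Subgroup.zpowers_le]; exact hfix
        exact this hh
      exact (IntermediateField.le_iff_le _ _).1 hle (Subgroup.mem_zpowers g)
    exact ⟨IntermediateField.fixingSubgroupEquiv F ⟨g, hgF⟩, fun x => rfl⟩
  have hrinj : ∀ r s : rootsOfUnity (p ^ n) k,
      algebraMap k K ((r : kˣ) : k) = algebraMap k K ((s : kˣ) : k) → r = s := by
    intro r s h
    exact Subtype.ext (Units.ext ((algebraMap k K).injective h))
  -- the group of pairs `(a, b)` with `a = b ^ (p ^ n)`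
  let P : Subgroup (kˣ × Kˣ) :=
    (((Units.map (algebraMap k K : k →+* K).toMonoidHom).comp (MonoidHom.fst kˣ Kˣ)).eqLocus
      ((powMonoidHom (p ^ n)).comp (MonoidHom.snd kˣ Kˣ)))
  have hPmem : ∀ ab : kˣ × Kˣ, ab ∈ P ↔ algebraMap k K (ab.1 : k) = (ab.2 : K) ^ p ^ n := by
    intro ab
    constructor
    · intro h
      have := congrArg (fun x : Kˣ => (x : K)) (show _ = _ from h)
      simpa using this
    · intro h
      change Units.map _ _ = _
      apply Units.ext
      simpa using h
  -- cocycle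
  have hcoc : ∀ (ab : P) (g : K ≃ₐ[k] K), ∃ x, g (ab.1.2 : K) = E x * (ab.1.2 : K) := by
    intro ab g
    have h := (hPmem ab.1).1 ab.2
    obtain ⟨x, hx⟩ := hEsurj (g (ab.1.2 : K) / (ab.1.2 : K)) (by
      rw [div_pow, ← map_pow, ← h, AlgEquiv.commutes, div_self]
      rw [h]
      exact pow_ne_zero _ ab.1.2.ne_zero)
    exact ⟨x, by rw [← hx, div_mul_cancel₀ _ ab.1.2.ne_zero]⟩
  have hR : ∀ (ab : P) (τ : K ≃ₐ[F] K), ∃ r : rootsOfUnity (p ^ n) k,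
      τ (ab.1.2 : K) = algebraMap k K ((r : kˣ) : k) * (ab.1.2 : K) := by
    intro ab τ
    obtain ⟨x, hx⟩ := hcoc ab (τ.restrictScalars k)
    have hx' : τ (ab.1.2 : K) = E x * (ab.1.2 : K) := hx
    have hfixed : ∀ g : K ≃ₐ[k] K, g (E x) = E x := by
      intro g
      obtain ⟨y, hy⟩ := hcoc ab g
      have h1 : g (τ (ab.1.2 : K)) = τ (g (ab.1.2 : K)) :=
        DFunLike.congr_fun (habelian g (τ.restrictScalars k)) (ab.1.2 : K)
      rw [hx', hy, map_mul, map_mul, hτE, hx', hy] at h1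
      have hne : E y * (ab.1.2 : K) ≠ 0 := mul_ne_zero (hEne y) ab.1.2.ne_zero
      apply mul_right_cancel₀ hne
      rw [h1]; ring
    obtain ⟨r, hr⟩ := (IsGalois.mem_range_algebraMap_iff_fixed (F := k) (E x)).2 hfixed
    have hrm : r ^ p ^ n = 1 := by
      apply (algebraMap k K).injective
      rw [map_pow, hr, hEm, map_one]
    refine ⟨rootsOfUnity.mkOfPowEq r hrm, ?_⟩
    rw [hx', ← hr]
    rfl
  choose R hR using hR
  let ψ : P →* ((K ≃ₐ[F] K) →* rootsOfUnity (p ^ n) k) :=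
    MonoidHom.mk' (fun ab => MonoidHom.mk' (R ab) (by
      intro τ τ'
      apply hrinj
      apply mul_right_cancel₀ ab.1.2.ne_zero
      rw [← hR, AlgEquiv.mul_apply, hR ab τ', map_mul, hR ab τ]
      have : τ (algebraMap k K ((R ab τ' : kˣ) : k)) = algebraMap k K ((R ab τ' : kˣ) : k) :=
        (τ.restrictScalars k).commutes _
      rw [this]
      simp only [Subgroup.coe_mul, Units.val_mul, map_mul]
      ring)) (by
      intro ab ab'
      ext1 τ
      apply hrinj
      apply mul_right_cancel₀ (ab * ab').1.2.ne_zero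
      change algebraMap k K ((R (ab * ab') τ : kˣ) : k) * _ =
        algebraMap k K (((R ab τ * R ab' τ : rootsOfUnity (p ^ n) k) : kˣ) : k) * _
      rw [← hR]
      simp only [Subgroup.coe_mul, Units.val_mul, map_mul, Prod.snd_mul]
      rw [hR ab τ, hR ab' τ]
      ring)
  have hψ : ∀ ab τ, ψ ab τ = R ab τ := fun _ _ => rfl
  have hφmem : ∀ ab : P, (QuotientGroup.mk' (powMonoidHom (p ^ n) : kˣ →* kˣ).range) ab.1.1 ∈
      powQuotKernel k K (p ^ n) := by
    intro ab
    rw [powQuotKernel, MonoidHom.mem_ker]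
    change QuotientGroup.mk (Units.map (algebraMap k K : k →+* K).toMonoidHom ab.1.1) = _
    rw [QuotientGroup.eq_one_iff]
    exact ⟨ab.1.2, ab.2.symm⟩
  let φ : P →* powQuotKernel k K (p ^ n) :=
    ((QuotientGroup.mk' (powMonoidHom (p ^ n) : kˣ →* kˣ).range).comp
      ((MonoidHom.fst kˣ Kˣ).comp P.subtype)).codRestrict _ hφmem
  have hφ1 : ∀ ab : P, φ ab = 1 ↔ ∃ c : kˣ, c ^ p ^ n = ab.1.1 := by
    intro ab
    rw [← OneMemClass.coe_eq_one]
    change (QuotientGroup.mk ab.1.1 : kˣ ⧸ (powMonoidHom (p ^ n) : kˣ →* kˣ).range) = 1 ↔ _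
    rw [QuotientGroup.eq_one_iff]
    rfl
  refine aux_iso φ ψ ?_ ?_ ?_
  · -- surjectivity onto the kernel
    rintro ⟨q, hq⟩
    obtain ⟨a, rfl⟩ := QuotientGroup.mk_surjective q
    rw [powQuotKernel, MonoidHom.mem_ker] at hq
    change QuotientGroup.mk (Units.map (algebraMap k K : k →+* K).toMonoidHom a) = _ at hq
    rw [QuotientGroup.eq_one_iff] at hq
    obtain ⟨b, hb⟩ := hq
    exact ⟨⟨(a, b), hb.symm⟩, rfl⟩
  · -- surjectivity onto the Hom group
    intro f
    have hf0 : ∀ τ, ∃ x, algebraMap k K ((f τ : kˣ) : k) = E x := by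
      intro τ
      apply hEsurj
      have : ((f τ : kˣ) : k) ^ p ^ n = 1 := by
        have := (mem_rootsOfUnity _ _).1 (f τ).2
        rw [← Units.val_pow_eq_pow_val, this, Units.val_one]
      rw [← map_pow, this, map_one]
    choose f0 hf0 using hf0
    have hf0add : ∀ τ τ', f0 (τ * τ') = f0 τ + f0 τ' := by
      intro τ τ'
      apply hEinj
      rw [hEadd, ← hf0, ← hf0, ← hf0, map_mul]
      simp
    choose L hL using hlift
    classical
    let f' : (K ≃ₐ[k] K) → ZMod (p ^ n) := fun g => if h : χ g = 1 then f0 (L g h) else 0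
    have hf' : ∀ g (h : χ g = 1), f' g = f0 (L g h) := fun g h => dif_pos h
    obtain ⟨c, hc1, hc2⟩ := aux_extend habelian χ σ hσ
      (hshapeB (χ σ) (fun a b => hspec a b σ)) f' (by
        intro g h hg hh
        have hgh : χ (g * h) = 1 := by rw [map_mul, hg, hh, one_mul]
        rw [hf' _ hg, hf' _ hh, hf' _ hgh, ← hf0add]
        congr 1
        ext x
        rw [AlgEquiv.mul_apply, hL, hL, hL, AlgEquiv.mul_apply]) (by
        intro g h hh
        apply hEinj
        rw [hf' _ hh, ← hEg, ← hf0, AlgEquiv.commutes])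
    have hcocy : groupCohomology.IsMulCocycle₁
        (fun g : K ≃ₐ[k] K => Units.mk0 (E (c g)) (hEne (c g))) := by
      intro g h
      apply Units.ext
      change E (c (g * h)) = g (E (c h)) * E (c g)
      rw [hc1, hEadd, hEg]
    obtain ⟨b, hb⟩ :=
      groupCohomology.isMulCoboundary₁_of_isMulCocycle₁_of_aut_to_units _ hcocy
    have hb' : ∀ g : K ≃ₐ[k] K, g (b : K) = E (c g) * (b : K) := by
      intro g
      have := congrArg (fun x : Kˣ => (x : K)) (div_eq_iff_eq_mul.1 (hb g))
      exact this
    obtain ⟨a, ha⟩ := (IsGalois.mem_range_algebraMap_iff_fixed (F := k) ((b : K) ^ p ^ n)).2 (by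
      intro g
      rw [map_pow, hb', mul_pow, hEm, one_mul])
    have ha0 : a ≠ 0 := by
      rintro rfl
      rw [map_zero] at ha
      exact pow_ne_zero _ b.ne_zero ha.symm
    refine ⟨⟨(Units.mk0 a ha0, b), (hPmem _).2 ha⟩, ?_⟩
    ext1 τ
    apply hrinj
    rw [hψ]
    apply mul_right_cancel₀ b.ne_zero
    rw [← hR ⟨(Units.mk0 a ha0, b), (hPmem _).2 ha⟩ τ]
    change (τ.restrictScalars k) (b : K) = _
    rw [hb', hc2 _ (hχτ τ), hf' _ (hχτ τ), hf0]
    congr 3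
    ext x
    rw [hL]
    rfl
  · -- equality of kernels
    ext ab
    rw [MonoidHom.mem_ker, MonoidHom.mem_ker, hφ1]
    have hab := (hPmem ab.1).1 ab.2
    constructor
    · rintro ⟨c, hc⟩
      ext1 τ
      apply hrinj
      rw [hψ]
      apply mul_right_cancel₀ ab.1.2.ne_zero
      rw [← hR]
      have hc0 : algebraMap k K (c : k) ≠ 0 := by
        rw [Ne, map_eq_zero]; exact c.ne_zero
      obtain ⟨x, hx⟩ := hEsurj ((ab.1.2 : K) / algebraMap k K (c : k)) (by
        rw [div_pow, ← hab, ← hc, Units.val_pow_eq_pow_val, map_pow, div_self]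
        exact pow_ne_zero _ hc0)
      rw [div_eq_iff hc0] at hx
      have h2 : τ (algebraMap k K (c : k)) = algebraMap k K (c : k) :=
        (τ.restrictScalars k).commutes _
      rw [hx, map_mul, hτE, h2]
      simp
    · intro h
      have hfixF : ∀ g : K ≃ₐ[k] K, χ g = 1 → g (ab.1.2 : K) = ab.1.2 := by
        intro g hg
        obtain ⟨τ, hτ⟩ := hlift g hg
        rw [← hτ, hR, ← hψ, h]
        simp
      obtain ⟨x, hx⟩ := hcoc ab σ
      have hpow : ∀ i : ℕ, (σ ^ i) (ab.1.2 : K) =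
          E ((∑ j ∈ Finset.range i, (χ σ : ZMod (p ^ n)) ^ j) * x) * (ab.1.2 : K) := by
        intro i
        induction i with
        | zero => simp [hE0]
        | succ i ih =>
          rw [pow_succ, AlgEquiv.mul_apply, hx, map_mul, ih, hEg, ← mul_assoc, ← hEadd,
            Finset.sum_range_succ, map_pow, Units.val_pow_eq_pow_val]
          congr 2
          ring
      obtain ⟨y, hy⟩ := hshape (χ σ) (fun a b => hspec a b σ) x (by
        apply hEinj
        apply mul_right_cancel₀ ab.1.2.ne_zero
        rw [← hpow, hfixF, hE0, one_mul]
        rw [map_pow, pow_orderOf_eq_one])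
      have hb : ∀ g : K ≃ₐ[k] K, g ((ab.1.2 : K) * E (-y)) = (ab.1.2 : K) * E (-y) := by
        have h1 : σ ((ab.1.2 : K) * E (-y)) = (ab.1.2 : K) * E (-y) := by
          rw [map_mul, hx, hEg, mul_right_comm, ← hEadd, mul_comm, hy]
          congr 2
          ring
        have h2 : ∀ i : ℕ, (σ ^ i) ((ab.1.2 : K) * E (-y)) = (ab.1.2 : K) * E (-y) := by
          intro i
          induction i with
          | zero => simp
          | succ i ih => rw [pow_succ, AlgEquiv.mul_apply, h1, ih]
        intro g
        obtain ⟨i, hi⟩ := hσ g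
        have h3 : χ ((σ ^ i)⁻¹ * g) = 1 := by
          rw [map_mul, map_inv, map_pow, hi, inv_mul_cancel]
        have h4 : g = σ ^ i * ((σ ^ i)⁻¹ * g) := by group
        rw [h4, AlgEquiv.mul_apply, map_mul ((σ ^ i)⁻¹ * g), hfixF _ h3, hEg, h3, Units.val_one,
          one_mul, h2]
      obtain ⟨c, hc⟩ := (IsGalois.mem_range_algebraMap_iff_fixed (F := k) _).2 hb
      have hc0 : c ≠ 0 := by
        rintro rfl
        rw [map_zero] at hc
        exact mul_ne_zero ab.1.2.ne_zero (hEne _) hc.symm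
      refine ⟨Units.mk0 c hc0, ?_⟩
      apply Units.ext
      apply (algebraMap k K).injective
      rw [hab, Units.val_pow_eq_pow_val, Units.val_mk0, map_pow, hc, mul_pow, hEm, mul_one]
end
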